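/- arXiv:1806.05833 — 4 statements merged into one kernel-verified Lean document; each statement's English description precedes it below -/
import Mathlib

section
/- Let d ≥ 1, let S = {x_1, …, x_N} be a finite set of N ≥ d points of R^d, and let h ∈ R^d be nonzero, defining the linear classifier x ↦ sign(hᵀx). Then there exist a subset S_h ⊆ S of cardinality d − 1 and a unit vector g ∈ R^{d} satisfying gᵀx = 0 for every x ∈ S_h, such that for every point x_i ∈ S with gᵀx_i ≠ 0 one has sign(hᵀx_i) = sign(gᵀx_i). In other words, the hyperplane through the origin and the d − 1 points of S_h induces the same binary classification of S as h, except possibly on the points of S lying exactly on that hyperplane. -/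
open Matrix Finset

/-- sign(u) = +1 if u ≥ 0 and −1 otherwise. -/
noncomputable def sgn (u : ℝ) : ℝ := if 0 ≤ u then 1 else -1

/-- Fewer than `d` vectors of `ℝ^d` have a common nonzero orthogonal vector. -/
theorem exists_ne_zero_orthogonal_of_card_lt {d : ℕ} (T : Finset (Fin d → ℝ)) (hT : T.card < d) :
    ∃ k : Fin d → ℝ, k ≠ 0 ∧ ∀ x ∈ T, k ⬝ᵥ x = 0 := by
  let M : Matrix T (Fin d) ℝ := fun x => x.1
  have hker : LinearMap.ker M.mulVecLin ≠ ⊥ :=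
    LinearMap.ker_ne_bot_of_finrank_lt (by simpa using hT)
  obtain ⟨k, hk, hk0⟩ := Submodule.exists_mem_ne_zero_of_ne_bot hker
  refine ⟨k, hk0, fun x hx => ?_⟩
  rw [dotProduct_comm]
  exact congrFun (LinearMap.mem_ker.1 hk) ⟨x, hx⟩

/-- A perturbation of `a` of size at most `|a|` is zero or has the same sign as `a`. -/
theorem sgn_add_eq_of_abs_le {a b : ℝ} (hab : |b| ≤ |a|) (hne : a + b ≠ 0) :
    sgn (a + b) = sgn a := by
  have hiff : 0 ≤ a + b ↔ 0 ≤ a := by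
    rcases le_or_gt 0 a with ha | ha
    · rw [abs_of_nonneg ha] at hab
      have := neg_abs_le b
      constructor <;> intro <;> linarith
    · rw [abs_of_neg ha] at hab
      have := le_abs_self b
      have : a + b < 0 := lt_of_le_of_ne (by linarith) hne
      constructor <;> intro <;> linarith
  simp only [sgn, hiff]

/-- If a hyperplane compatible with `h` on `S` passes through fewer than `d - 1` points of `S`,
it can be rotated to a compatible hyperplane passing through more points of `S`. -/
theorem exists_compatible_card_lt {d : ℕ} (S : Finset (Fin d → ℝ)) (hS : d ≤ S.card)
    (h g : Fin d → ℝ) (hg : g ≠ 0)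
    (hgS : ∀ x ∈ S, g ⬝ᵥ x ≠ 0 → sgn (h ⬝ᵥ x) = sgn (g ⬝ᵥ x))
    (hcard : (S.filter fun x => g ⬝ᵥ x = 0).card + 1 < d) :
    ∃ g' : Fin d → ℝ, g' ≠ 0 ∧ (∀ x ∈ S, g' ⬝ᵥ x ≠ 0 → sgn (h ⬝ᵥ x) = sgn (g' ⬝ᵥ x)) ∧
      (S.filter fun x => g ⬝ᵥ x = 0).card < (S.filter fun x => g' ⬝ᵥ x = 0).card := by
  classical
  obtain ⟨k, hk, hkZ⟩ := exists_ne_zero_orthogonal_of_card_lt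
    (insert g (S.filter fun x => g ⬝ᵥ x = 0)) ((card_insert_le _ _).trans_lt hcard)
  have hkg : k ⬝ᵥ g = 0 := hkZ g (mem_insert_self _ _)
  have hkz : ∀ x ∈ S, g ⬝ᵥ x = 0 → k ⬝ᵥ x = 0 := fun x hx hgx =>
    hkZ x (mem_insert_of_mem (mem_filter.2 ⟨hx, hgx⟩))
  rcases (S.filter fun x => k ⬝ᵥ x ≠ 0).eq_empty_or_nonempty with hP | hP
  · have hkS : ∀ x ∈ S, k ⬝ᵥ x = 0 := by simpa [filter_eq_empty_iff] using hP
    refine ⟨k, hk, fun x hx hne => absurd (hkS x hx) hne, ?_⟩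
    rw [filter_true_of_mem hkS]
    omega
  · obtain ⟨x, hxP, hmin⟩ := exists_min_image _ (fun y => |g ⬝ᵥ y / (k ⬝ᵥ y)|) hP
    obtain ⟨hxS, hkx⟩ := mem_filter.1 hxP
    set t : ℝ := -(g ⬝ᵥ x / (k ⬝ᵥ x)) with ht
    have hval : ∀ y, (g + t • k) ⬝ᵥ y = g ⬝ᵥ y + t * (k ⬝ᵥ y) := fun y => by
      simp [add_dotProduct, smul_dotProduct]
    refine ⟨g + t • k, fun h0 => hg ?_, fun y hy hne => ?_, card_lt_card ?_⟩
    · have := hval g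
      rw [h0, hkg, zero_dotProduct, mul_zero, add_zero] at this
      exact dotProduct_self_eq_zero.1 this.symm
    · rw [hval] at hne ⊢
      have hgy : g ⬝ᵥ y ≠ 0 := fun h0 => hne (by rw [h0, hkz y hy h0]; simp)
      rw [hgS y hy hgy, sgn_add_eq_of_abs_le _ hne]
      by_cases hky : k ⬝ᵥ y = 0
      · simp [hky]
      · have := hmin y (mem_filter.2 ⟨hy, hky⟩)
        rw [abs_div (g ⬝ᵥ y), le_div_iff₀ (abs_pos.2 hky)] at this
        rwa [abs_mul, ht, abs_neg]
    · rw [ssubset_iff_of_subset]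
      · refine ⟨x, mem_filter.2 ⟨hxS, ?_⟩, fun hx => hkx (hkz x hxS (mem_filter.1 hx).2)⟩
        rw [hval, ht]
        field_simp
        ring
      · intro y hy
        obtain ⟨hyS, hgy⟩ := mem_filter.1 hy
        exact mem_filter.2 ⟨hyS, by rw [hval, hgy, hkz y hyS hgy]; simp⟩

/-- A hyperplane compatible with `h` on `S` can be made to pass through any number `n < d` of
points of `S`. -/
theorem exists_compatible_le_card {d : ℕ} (S : Finset (Fin d → ℝ)) (hS : d ≤ S.card)
    (h : Fin d → ℝ) (hh : h ≠ 0) (n : ℕ) (hn : n < d) :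
    ∃ g : Fin d → ℝ, g ≠ 0 ∧ (∀ x ∈ S, g ⬝ᵥ x ≠ 0 → sgn (h ⬝ᵥ x) = sgn (g ⬝ᵥ x)) ∧
      n ≤ (S.filter fun x => g ⬝ᵥ x = 0).card := by
  induction n with
  | zero => exact ⟨h, hh, fun _ _ _ => rfl, Nat.zero_le _⟩
  | succ n ih =>
    obtain ⟨g, hg, hgS, hgn⟩ := ih (by omega)
    by_cases hc : n + 1 ≤ (S.filter fun x => g ⬝ᵥ x = 0).card
    · exact ⟨g, hg, hgS, hc⟩
    · obtain ⟨g', hg', hgS', hlt⟩ := exists_compatible_card_lt S hS h g hg hgS (by omega)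
      exact ⟨g', hg', hgS', by omega⟩

/-- Positive scaling preserves the sign. -/
theorem sgn_mul_of_pos {c : ℝ} (hc : 0 < c) (u : ℝ) : sgn (c * u) = sgn u := by
  simp only [sgn, mul_nonneg_iff_of_pos_left hc]

/-- Proposition 1: for any linear classifier `x ↦ sign(hᵀx)` on a finite set `S` of `N ≥ d`
points of `ℝ^d`, there is a hyperplane through the origin and `d − 1` points of `S` inducing
the same classification of `S`, except possibly on points lying exactly on that hyperplane. -/
theorem stmt0 (d N : ℕ) (hd : 1 ≤ d) (S : Finset (Fin d → ℝ)) (hS : S.card = N)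
    (hN : d ≤ N) (h : Fin d → ℝ) (hh : h ≠ 0) :
    ∃ Sh ⊆ S, Sh.card = d - 1 ∧
      ∃ g : Fin d → ℝ, g ⬝ᵥ g = 1 ∧ (∀ x ∈ Sh, g ⬝ᵥ x = 0) ∧
        ∀ x ∈ S, g ⬝ᵥ x ≠ 0 → sgn (h ⬝ᵥ x) = sgn (g ⬝ᵥ x) := by
  obtain ⟨g, hg, hgS, hgc⟩ :=
    exists_compatible_le_card S (hS ▸ hN) h hh (d - 1) (by omega)
  obtain ⟨Sh, hSh, hShc⟩ := exists_subset_card_eq hgc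
  have hgg : 0 < g ⬝ᵥ g :=
    lt_of_le_of_ne (sum_nonneg fun i _ => mul_self_nonneg (g i))
      fun h0 => hg (dotProduct_self_eq_zero.1 h0.symm)
  have hc : 0 < (√(g ⬝ᵥ g))⁻¹ := inv_pos.2 (Real.sqrt_pos.2 hgg)
  refine ⟨Sh, hSh.trans (filter_subset _ _), hShc, (√(g ⬝ᵥ g))⁻¹ • g, ?_, fun x hx => ?_,
    fun x hx hne => ?_⟩
  · rw [smul_dotProduct, dotProduct_smul, smul_eq_mul, smul_eq_mul, ← mul_assoc, ← mul_inv,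
      Real.mul_self_sqrt hgg.le, inv_mul_cancel₀ hgg.ne']
  · rw [smul_dotProduct, (mem_filter.1 (hSh hx)).2, smul_zero]
  · rw [smul_dotProduct, smul_eq_mul] at hne ⊢
    rw [sgn_mul_of_pos hc]
    exact hgS x hx (right_ne_zero_of_mul hne)
end

section
/- Let p ∈ {1,2} and let w* ∈ R^d be a global minimizer of J_p over R^d. If ŵ ∈ R^d satisfies Σ_{i ∈ I_1(w*)} |y_i − ŵᵀx_i|^p ≤ Σ_{i ∈ I_1(w*)} |y_i − (w*)ᵀx_i|^p, then J_p(ŵ) = J_p(w*); that is, any minimizer of the ordinary (non-saturated) ℓ_p regression problem restricted to the data points indexed by I_1(w*) is also a global minimizer of the saturated-loss objective J_p. -/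
open Matrix Finset

/-- Saturated loss: `ℓ_{0,ε}(e) = 1` if `|e| > ε` and `0` otherwise;
`ℓ_{p,ε}(e) = (min(|e|, ε))^p` for `p ∈ {1,2}`. -/
noncomputable def satLoss (p : ℕ) (ε e : ℝ) : ℝ :=
  if p = 0 then (if ε < |e| then 1 else 0) else (min |e| ε) ^ p

/-- Objective `J_p(w) = Σ_{i=1}^N ℓ_{p,ε}(y_i − wᵀx_i)`. -/
noncomputable def Jreg (d N : ℕ) (x : Fin N → Fin d → ℝ) (y : Fin N → ℝ) (ε : ℝ) (p : ℕ)
    (w : Fin d → ℝ) : ℝ :=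
  ∑ i, satLoss p ε (y i - w ⬝ᵥ x i)

/-- For `p ∈ {1,2}` and a global minimizer `w*` of `J_p`, any `ŵ` achieving a no-larger
ordinary `ℓ_p` cost on the inlier set `I_1(w*) = {i : |y_i − w*ᵀx_i| < ε}` is also a global
minimizer of the saturated-loss objective `J_p`. -/
theorem stmt6 (d N p : ℕ) (hp : p = 1 ∨ p = 2)
    (x : Fin N → Fin d → ℝ) (y : Fin N → ℝ) (ε : ℝ) (hε : 0 < ε)
    (wstar : Fin d → ℝ)
    (hmin : ∀ w : Fin d → ℝ, Jreg d N x y ε p wstar ≤ Jreg d N x y ε p w)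
    (what : Fin d → ℝ)
    (hle : ∑ i ∈ univ.filter (fun i : Fin N => |y i - wstar ⬝ᵥ x i| < ε),
             |y i - what ⬝ᵥ x i| ^ p
         ≤ ∑ i ∈ univ.filter (fun i : Fin N => |y i - wstar ⬝ᵥ x i| < ε),
             |y i - wstar ⬝ᵥ x i| ^ p) :
    Jreg d N x y ε p what = Jreg d N x y ε p wstar := by
  refine le_antisymm ?_ (hmin what)
  have hp0 : p ≠ 0 := by omega
  unfold Jreg
  simp only [satLoss, if_neg hp0]
  rw [← sum_filter_add_sum_filter_not univ (fun i : Fin N => |y i - wstar ⬝ᵥ x i| < ε),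
    ← sum_filter_add_sum_filter_not univ (fun i : Fin N => |y i - wstar ⬝ᵥ x i| < ε)
      (fun i => min |y i - wstar ⬝ᵥ x i| ε ^ p)]
  refine add_le_add ?_ (sum_le_sum fun i hi => ?_)
  · calc
      _ ≤ ∑ i ∈ univ.filter (fun i : Fin N => |y i - wstar ⬝ᵥ x i| < ε),
            |y i - what ⬝ᵥ x i| ^ p :=
        sum_le_sum fun i _ =>
          pow_le_pow_left₀ (le_min (abs_nonneg _) hε.le) (min_le_left _ _) p
      _ ≤ _ := hle
      _ = _ := sum_congr rfl fun i hi => by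
        rw [min_eq_left (mem_filter.mp hi).2.le]
  · rw [min_eq_right (not_lt.mp (mem_filter.mp hi).2)]
    exact pow_le_pow_left₀ (le_min (abs_nonneg _) hε.le) (min_le_right _ _) p
end

section
/- Let B ∈ R^{d×d_s} satisfy BᵀB = I. Then there exists a vector h ∈ R^{D+1}, depending only on B, with first coordinate h_1 = 1, such that for every x ∈ R^d: ‖(I − BBᵀ)x‖ < ε if and only if hᵀ(−ε², ν(x)ᵀ)ᵀ < 0 (the remaining coordinates of h being the coefficients of the quadratic form x ↦ ‖x‖² − ‖Bᵀx‖² in the monomial basis (x_k x_l)_{1≤k≤l≤d}). Consequently, for data points x_1, …, x_N and the lifted points z_i = (−ε², ν(x_i)ᵀ)ᵀ ∈ R^{D+1}, the inlier set satisfies I_1(B) = { i ∈ {1,…,N} : hᵀz_i < 0 }, i.e., I_1(B) is determined by a linear classification of the lifted points z_i. -/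
open Matrix Finset

/-- Index set for the degree-2 Veronese coordinates `(x_k x_l)_{1 ≤ k ≤ l ≤ d}`; it has
`D = d(d+1)/2` elements. -/
def SymIdx (d : ℕ) := {p : Fin d × Fin d // p.1 ≤ p.2}

instance (d : ℕ) : Fintype (SymIdx d) := by unfold SymIdx; infer_instance

/-- Veronese map of degree 2: `ν(x) = (x_k x_l)_{1 ≤ k ≤ l ≤ d} ∈ ℝ^D`. -/
def vero (d : ℕ) (x : Fin d → ℝ) : SymIdx d → ℝ := fun p => x p.1.1 * x p.1.2

/-- The coefficients, in the monomials `x_k x_l` with `k ≤ l`, of the quadratic form of `A`. -/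
def veroCoeff {d : ℕ} (A : Matrix (Fin d) (Fin d) ℝ) : SymIdx d → ℝ :=
  fun p => if p.1.1 = p.1.2 then A p.1.1 p.1.2 else A p.1.1 p.1.2 + A p.1.2 p.1.1

theorem veroCoeff_dotProduct_vero {d : ℕ} (A : Matrix (Fin d) (Fin d) ℝ) (v : Fin d → ℝ) :
    veroCoeff A ⬝ᵥ vero d v = v ⬝ᵥ (A *ᵥ v) := by
  let F : Fin d × Fin d → ℝ := fun p => v p.1 * (A p.1 p.2 * v p.2)
  have hswap : ∑ p : Fin d × Fin d with p.1 < p.2, F p.swap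
      = ∑ p : Fin d × Fin d with ¬ p.1 ≤ p.2, F p :=
    Finset.sum_nbij' Prod.swap Prod.swap (by simp) (by simp) (by simp) (by simp) (by simp)
  have hsum : v ⬝ᵥ (A *ᵥ v) = ∑ p, F p := by
    simp [F, dotProduct, mulVec, Finset.mul_sum, Fintype.sum_prod_type]
  have hlift : veroCoeff A ⬝ᵥ vero d v
      = ∑ p : Fin d × Fin d with p.1 ≤ p.2, (F p + if p.1 < p.2 then F p.swap else 0) := by
    rw [Finset.sum_subtype (p := fun p : Fin d × Fin d => p.1 ≤ p.2) _ (by simp)]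
    refine Fintype.sum_congr _ _ fun ⟨⟨k, l⟩, hkl⟩ => ?_
    rcases eq_or_lt_of_le hkl with h | h
    · simp only at h
      subst h
      simp [F, veroCoeff, vero]
      ring
    · simp only at h
      simp [F, veroCoeff, vero, h, h.ne]
      ring
  have hlt : ∑ p : Fin d × Fin d with p.1 ≤ p.2, (if p.1 < p.2 then F p.swap else 0)
      = ∑ p : Fin d × Fin d with p.1 < p.2, F p.swap := by
    rw [← Finset.sum_filter, Finset.filter_filter]
    congr 1
    ext p
    simpa using le_of_lt
  rw [hlift, Finset.sum_add_distrib, hlt, hswap, Finset.sum_filter_add_sum_filter_not, hsum]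

/-- Lemma 3: for `B` with orthonormal columns there is `h ∈ ℝ^{D+1}` (represented as a pair
`(h_1, (h_2,…,h_{D+1}))`) with first coordinate `h_1 = 1` such that for every `x ∈ ℝ^d`,
`‖(I − BBᵀ)x‖ < ε ⟺ hᵀ(−ε², ν(x)ᵀ)ᵀ < 0`; consequently, for data points `x_1, …, x_N`,
the inlier set `I_1(B)` is the set of `i` with `hᵀz_i < 0` for the lifted points
`z_i = (−ε², ν(x_i)ᵀ)ᵀ`. -/
theorem stmt10 (d ds N : ℕ) (hds : ds < d) (ε : ℝ) (hε : 0 < ε)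
    (B : Matrix (Fin d) (Fin ds) ℝ) (hB : Bᵀ * B = 1)
    (x : Fin N → Fin d → ℝ) :
    ∃ h : ℝ × (SymIdx d → ℝ), h.1 = 1 ∧
      (∀ v : Fin d → ℝ,
        Real.sqrt ((((1 : Matrix (Fin d) (Fin d) ℝ) - B * Bᵀ) *ᵥ v) ⬝ᵥ
            (((1 : Matrix (Fin d) (Fin d) ℝ) - B * Bᵀ) *ᵥ v)) < ε
          ↔ h.1 * (-ε ^ 2) + h.2 ⬝ᵥ vero d v < 0) ∧
      univ.filter (fun i : Fin N =>
          Real.sqrt ((((1 : Matrix (Fin d) (Fin d) ℝ) - B * Bᵀ) *ᵥ x i) ⬝ᵥ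
            (((1 : Matrix (Fin d) (Fin d) ℝ) - B * Bᵀ) *ᵥ x i)) < ε)
        = univ.filter (fun i : Fin N => h.1 * (-ε ^ 2) + h.2 ⬝ᵥ vero d (x i) < 0) := by
  set M := (1 : Matrix (Fin d) (Fin d) ℝ) - B * Bᵀ
  have key (v : Fin d → ℝ) : Real.sqrt ((M *ᵥ v) ⬝ᵥ (M *ᵥ v)) < ε
      ↔ 1 * (-ε ^ 2) + veroCoeff (Mᵀ * M) ⬝ᵥ vero d v < 0 := by
    have hquad : veroCoeff (Mᵀ * M) ⬝ᵥ vero d v = (M *ᵥ v) ⬝ᵥ (M *ᵥ v) := by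
      rw [veroCoeff_dotProduct_vero, ← mulVec_mulVec, dotProduct_mulVec, vecMul_transpose]
    rw [hquad, Real.sqrt_lt' hε, one_mul, neg_add_lt_iff_lt_add, add_zero]
  exact ⟨(1, veroCoeff (Mᵀ * M)), rfl, key, Finset.filter_congr fun i _ => key (x i)⟩
end

section
/- Let p ∈ {1,2} and let B* ∈ R^{d×d_s} with (B*)ᵀB* = I be a global minimizer of J_p^S over matrices with orthonormal columns. If B̂ ∈ R^{d×d_s} satisfies B̂ᵀB̂ = I and Σ_{i ∈ I_1(B*)} ‖(I − B̂B̂ᵀ)x_i‖^p ≤ Σ_{i ∈ I_1(B*)} ‖(I − B*(B*)ᵀ)x_i‖^p, then J_p^S(B̂) = J_p^S(B*); that is, any minimizer of the ordinary (non-saturated) subspace estimation problem restricted to the points indexed by I_1(B*) is also a global minimizer of the saturated-loss objective J_p^S. -/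
open Matrix Finset

/-- Distance `‖(I − BBᵀ)x‖` from `x` to the column space of `B`. -/
noncomputable def subErr (d ds : ℕ) (B : Matrix (Fin d) (Fin ds) ℝ) (x : Fin d → ℝ) : ℝ :=
  Real.sqrt ((((1 : Matrix (Fin d) (Fin d) ℝ) - B * Bᵀ) *ᵥ x) ⬝ᵥ
    (((1 : Matrix (Fin d) (Fin d) ℝ) - B * Bᵀ) *ᵥ x))

/-- Objective `J_p^S(B) = Σ_{i=1}^N ℓ_{p,ε}(‖(I − BBᵀ)x_i‖)`. -/
noncomputable def JS (d ds N : ℕ) (x : Fin N → Fin d → ℝ) (ε : ℝ) (p : ℕ)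
    (B : Matrix (Fin d) (Fin ds) ℝ) : ℝ :=
  ∑ i, satLoss p ε (subErr d ds B (x i))

theorem subErr_nonneg (d ds : ℕ) (B : Matrix (Fin d) (Fin ds) ℝ) (x : Fin d → ℝ) :
    0 ≤ subErr d ds B x :=
  Real.sqrt_nonneg _

theorem satLoss_of_nonneg {p : ℕ} (hp : p ≠ 0) (ε : ℝ) {e : ℝ} (he : 0 ≤ e) :
    satLoss p ε e = (min e ε) ^ p := by
  rw [satLoss, if_neg hp, abs_of_nonneg he]

theorem JS_eq_sum_min_pow (d ds N : ℕ) (x : Fin N → Fin d → ℝ) (ε : ℝ) {p : ℕ} (hp : p ≠ 0)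
    (B : Matrix (Fin d) (Fin ds) ℝ) :
    JS d ds N x ε p B = ∑ i, (min (subErr d ds B (x i)) ε) ^ p :=
  sum_congr rfl fun _ _ => satLoss_of_nonneg hp ε (subErr_nonneg d ds B _)

/-- For `p ∈ {1,2}` and a global minimizer `B*` of `J_p^S` over orthonormal bases, any
orthonormal `B̂` achieving a no-larger ordinary cost on the inlier set
`I_1(B*) = {i : ‖(I − B*(B*)ᵀ)x_i‖ < ε}` is also a global minimizer of `J_p^S`. -/
theorem stmt13 (d ds N p : ℕ) (hds : ds < d) (hp : p = 1 ∨ p = 2)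
    (x : Fin N → Fin d → ℝ) (ε : ℝ) (hε : 0 < ε)
    (Bstar : Matrix (Fin d) (Fin ds) ℝ) (hBstar : Bstarᵀ * Bstar = 1)
    (hmin : ∀ B : Matrix (Fin d) (Fin ds) ℝ, Bᵀ * B = 1 →
      JS d ds N x ε p Bstar ≤ JS d ds N x ε p B)
    (Bhat : Matrix (Fin d) (Fin ds) ℝ) (hBhat : Bhatᵀ * Bhat = 1)
    (hle : ∑ i ∈ univ.filter (fun i : Fin N => subErr d ds Bstar (x i) < ε),
             subErr d ds Bhat (x i) ^ p
         ≤ ∑ i ∈ univ.filter (fun i : Fin N => subErr d ds Bstar (x i) < ε),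
             subErr d ds Bstar (x i) ^ p) :
    JS d ds N x ε p Bhat = JS d ds N x ε p Bstar := by
  have hp0 : p ≠ 0 := by omega
  refine le_antisymm ?_ (hmin Bhat hBhat)
  have hmin_nonneg : ∀ i, 0 ≤ min (subErr d ds Bhat (x i)) ε := fun i =>
    le_min (subErr_nonneg d ds Bhat (x i)) hε.le
  rw [JS_eq_sum_min_pow d ds N x ε hp0, JS_eq_sum_min_pow d ds N x ε hp0,
    ← sum_filter_add_sum_filter_not univ (fun i : Fin N => subErr d ds Bstar (x i) < ε),
    ← sum_filter_add_sum_filter_not univ (fun i : Fin N => subErr d ds Bstar (x i) < ε)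
      (fun i => (min (subErr d ds Bstar (x i)) ε) ^ p)]
  refine add_le_add ?_ (sum_le_sum fun i hi => ?_)
  · calc
      _ ≤ _ := sum_le_sum fun i _ => pow_le_pow_left₀ (hmin_nonneg i) (min_le_left _ _) p
      _ ≤ _ := hle
      _ = _ := sum_congr rfl fun i hi => by rw [min_eq_left (mem_filter.1 hi).2.le]
  · rw [min_eq_right (not_lt.1 (mem_filter.1 hi).2)]
    exact pow_le_pow_left₀ (hmin_nonneg i) (min_le_right _ _) p
end
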